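/- With A₁(P) as defined by the multilinearity and slide relations on Y-symbols with entries in P = H ⊕ ℤ/2 (H = ℤⁿ), the map ρ sending Y[(e_i,0);(e_j,0);(e_k,0)] ↦ e_i∧e_j∧e_k ∈ Λ³H, Y[(e_i,0);(e_j,0);(0,1)] ↦ ē_i∧ē_j ∈ Λ²H₍₂₎, Y[(e_i,0);(0,1);(0,1)] ↦ ē_i ∈ H₍₂₎, and Y[(0,1);(0,1);(0,1)] ↦ 1 ∈ ℤ/2, is a well-defined isomorphism of abelian groups A₁(P) ≅ Λ³H ⊕ Λ²H₍₂₎ ⊕ H₍₂₎ ⊕ ℤ/2. -/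

import Mathlib

set_option synthInstance.maxHeartbeats 1000000
set_option maxHeartbeats 1000000

/-- `P = H ⊕ ℤ/2` with `H = ℤⁿ`. -/
abbrev PGrp (n : ℕ) := (Fin n → ℤ) × ZMod 2

/-- The distinguished element `s = (0,1)` of `P`. -/
def sP (n : ℕ) : PGrp n := (0, 1)

/-- The relations defining `A₁(P)`: multilinearity in the first slot, cyclic symmetry, and
the slide relation `Y[z;z;w] = Y[s;z;w]` (these together give multilinearity in each slot). -/
def A1rels (n : ℕ) : AddSubgroup (FreeAbelianGroup (PGrp n × PGrp n × PGrp n)) :=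
  AddSubgroup.closure
    ({x | ∃ a b c d : PGrp n, x = FreeAbelianGroup.of (a + b, c, d) -
        FreeAbelianGroup.of (a, c, d) - FreeAbelianGroup.of (b, c, d)} ∪
     {x | ∃ a b c : PGrp n, x = FreeAbelianGroup.of (a, b, c) -
        FreeAbelianGroup.of (b, c, a)} ∪
     {x | ∃ a b : PGrp n, x = FreeAbelianGroup.of (a, a, b) -
        FreeAbelianGroup.of (sP n, a, b)})

/-- The abelian group `A₁(P)` of `Y`-shaped diagrams with univalent vertices labelled by
`P = ℤⁿ ⊕ ℤ/2`, modulo multilinearity, cyclic symmetry and the slide relation. -/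
def A1 (n : ℕ) := FreeAbelianGroup (PGrp n × PGrp n × PGrp n) ⧸ A1rels n

instance (n : ℕ) : AddCommGroup (A1 n) := by
  unfold A1; infer_instance

/-- The generator `Y[z₁;z₂;z₃]` of `A₁(P)`. -/
def Ymk (n : ℕ) (z₁ z₂ z₃ : PGrp n) : A1 n :=
  QuotientAddGroup.mk (FreeAbelianGroup.of (z₁, z₂, z₃))

/-- The wedge of a family, as an element of the exterior power `⋀[R]^k M`. -/
noncomputable def wedge {R M : Type*} [CommRing R] [AddCommGroup M] [Module R M]
    (k : ℕ) (v : Fin k → M) : ⋀[R]^k M :=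
  ⟨ExteriorAlgebra.ιMulti R k v, ExteriorAlgebra.ιMulti_range R k (Set.mem_range_self v)⟩

/-- The basis vector `eᵢ` of `H = ℤⁿ`. -/
def eZ (n : ℕ) (i : Fin n) : Fin n → ℤ := Pi.single i 1

/-- The basis vector `ēᵢ` of `H₍₂₎ = (ℤ/2)ⁿ`. -/
def eZ2 (n : ℕ) (i : Fin n) : Fin n → ZMod 2 := Pi.single i 1


section Helpers

variable {n : ℕ}

lemma Ymk_add1 (a b c d : PGrp n) : Ymk n (a + b) c d = Ymk n a c d + Ymk n b c d := by
  have h : FreeAbelianGroup.of (a + b, c, d) - FreeAbelianGroup.of (a, c, d) -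
      FreeAbelianGroup.of (b, c, d) ∈ A1rels n :=
    AddSubgroup.subset_closure (Or.inl (Or.inl ⟨a, b, c, d, rfl⟩))
  have h2 := (QuotientAddGroup.eq_zero_iff _).2 h
  rw [sub_sub] at h2
  exact sub_eq_zero.1 h2

lemma Ymk_cyc (a b c : PGrp n) : Ymk n a b c = Ymk n b c a := by
  have h : FreeAbelianGroup.of (a, b, c) - FreeAbelianGroup.of (b, c, a) ∈ A1rels n :=
    AddSubgroup.subset_closure (Or.inl (Or.inr ⟨a, b, c, rfl⟩))
  have h2 := (QuotientAddGroup.eq_zero_iff _).2 h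
  exact sub_eq_zero.1 h2

lemma Ymk_slide (a b : PGrp n) : Ymk n a a b = Ymk n (sP n) a b := by
  have h : FreeAbelianGroup.of (a, a, b) - FreeAbelianGroup.of (sP n, a, b) ∈ A1rels n :=
    AddSubgroup.subset_closure (Or.inr ⟨a, b, rfl⟩)
  have h2 := (QuotientAddGroup.eq_zero_iff _).2 h
  exact sub_eq_zero.1 h2

lemma Ymk_add2 (a b c d : PGrp n) : Ymk n c (a + b) d = Ymk n c a d + Ymk n c b d := by
  rw [Ymk_cyc c, Ymk_add1, ← Ymk_cyc c a d, ← Ymk_cyc c b d]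

lemma Ymk_swap (a b c : PGrp n) : Ymk n a b c = - Ymk n b a c := by
  have h := Ymk_slide (a + b) c
  simp only [Ymk_add1, Ymk_add2] at h
  rw [Ymk_slide a, Ymk_slide b] at h
  rw [eq_neg_iff_add_eq_zero]
  have : Ymk n a b c + Ymk n b a c =
    (Ymk n (sP n) a c + Ymk n b a c + (Ymk n a b c + Ymk n (sP n) b c))
      - (Ymk n (sP n) a c + Ymk n (sP n) b c) := by abel
  rw [this, h, sub_self]

/-- `Ymk` as a homomorphism in its first slot. -/
def Yhom (b c : PGrp n) : PGrp n →+ A1 n :=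
  AddMonoidHom.mk' (fun a => Ymk n a b c) (fun x y => Ymk_add1 x y b c)

lemma two_sP : sP n + sP n = 0 := by
  ext
  · simp [sP]
  · simp only [sP, Prod.snd_add, Prod.snd_zero]; decide

lemma Ymk_s_two (b c : PGrp n) : (2 : ℕ) • Ymk n (sP n) b c = 0 := by
  rw [two_nsmul, ← Ymk_add1, two_sP]
  exact (Yhom b c).map_zero

/-- The set of standard generators. -/
inductive IsStd : A1 n → Prop
  | eee (i j k : Fin n) (h : i < j) (h' : j < k) :
      IsStd (Ymk n (eZ n i, 0) (eZ n j, 0) (eZ n k, 0))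
  | ees (i j : Fin n) (h : i < j) : IsStd (Ymk n (eZ n i, 0) (eZ n j, 0) (sP n))
  | ess (i : Fin n) : IsStd (Ymk n (eZ n i, 0) (sP n) (sP n))
  | sss : IsStd (Ymk n (sP n) (sP n) (sP n))

/-- The basis elements of `P`. -/
inductive IsB : PGrp n → Prop
  | e (i : Fin n) : IsB (eZ n i, 0)
  | s : IsB (sP n)

/-- The subgroup generated by the standard generators. -/
def SS (n : ℕ) : AddSubgroup (A1 n) := AddSubgroup.closure {x | IsStd x}

lemma SS_swap {a b c : PGrp n} (h : Ymk n b a c ∈ SS n) : Ymk n a b c ∈ SS n := by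
  rw [Ymk_swap]; exact neg_mem h

lemma SS_cyc {a b c : PGrp n} (h : Ymk n b c a ∈ SS n) : Ymk n a b c ∈ SS n := by
  rw [Ymk_cyc]; exact h

lemma SS_std {x : A1 n} (h : IsStd x) : x ∈ SS n := AddSubgroup.subset_closure h

lemma SS_s {a c : PGrp n} (ha : IsB a) (hc : IsB c) : Ymk n (sP n) a c ∈ SS n := by
  cases ha with
  | s => cases hc with
    | s => exact SS_std .sss
    | e i => exact SS_cyc (SS_cyc (SS_std (.ess i)))
  | e i => cases hc with
    | s => exact SS_cyc (SS_std (.ess i))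
    | e j =>
      apply SS_cyc
      rcases lt_trichotomy i j with h | rfl | h
      · exact SS_std (.ees i j h)
      · rw [Ymk_slide]
        exact SS_cyc (SS_std (.ess i))
      · exact SS_swap (SS_std (.ees j i h))

lemma SS_sorted {i j k : Fin n} (h : i ≠ j) (h' : j ≠ k) (h'' : i ≠ k) :
    Ymk n (eZ n i, 0) (eZ n j, 0) (eZ n k, 0) ∈ SS n := by
  rcases lt_or_gt_of_ne h with h | h <;> rcases lt_or_gt_of_ne h' with h' | h' <;>
    rcases lt_or_gt_of_ne h'' with h'' | h''
  · exact SS_std (.eee _ _ _ h h')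
  · exact absurd (h.trans h') (not_lt.2 h''.le)
  · exact SS_swap (SS_cyc (SS_std (.eee _ _ _ h'' h')))
  · exact SS_cyc (SS_cyc (SS_std (.eee _ _ _ h'' h)))
  · exact SS_swap (SS_std (.eee _ _ _ h h''))
  · exact SS_cyc (SS_std (.eee _ _ _ h' h''))
  · exact absurd (h'.trans h) (not_lt.2 h''.le)
  · exact SS_swap (SS_cyc (SS_cyc (SS_std (.eee _ _ _ h' h))))

lemma SS_basis {a b c : PGrp n} (ha : IsB a) (hb : IsB b) (hc : IsB c) :
    Ymk n a b c ∈ SS n := by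
  by_cases h1 : a = b
  · subst h1; rw [Ymk_slide]; exact SS_s ha hc
  by_cases h2 : b = c
  · subst h2; apply SS_cyc; rw [Ymk_slide]; exact SS_s hb ha
  by_cases h3 : a = c
  · subst h3; apply SS_cyc; apply SS_cyc; rw [Ymk_slide]; exact SS_s ha hb
  cases ha with
  | s => exact SS_s hb hc
  | e i => cases hb with
    | s => exact SS_cyc (SS_s hc (.e i))
    | e j => cases hc with
      | s => exact SS_cyc (SS_cyc (SS_s (.e i) (.e j)))
      | e k =>
        apply SS_sorted
        · rintro rfl; exact h1 rfl
        · rintro rfl; exact h2 rfl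
        · rintro rfl; exact h3 rfl

lemma IsB_closure : AddSubgroup.closure {x : PGrp n | IsB x} = ⊤ := by
  rw [eq_top_iff]
  rintro ⟨x, α⟩ -
  have hx : ((x, α) : PGrp n) = ∑ i, x i • ((eZ n i, 0) : PGrp n) + α.val • sP n := by
    ext j
    · simp [sP, eZ, Prod.fst_sum, Finset.sum_apply, Pi.single_apply]
    · simp [sP, Prod.snd_sum]
  rw [hx]
  refine add_mem (sum_mem fun i _ => zsmul_mem ?_ _) (nsmul_mem ?_ _)
  · exact AddSubgroup.subset_closure (.e i)
  · exact AddSubgroup.subset_closure .s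

lemma SS_ext1 {b c : PGrp n} (h : ∀ a, IsB a → Ymk n a b c ∈ SS n) (a : PGrp n) :
    Ymk n a b c ∈ SS n := by
  have : AddSubgroup.closure {x : PGrp n | IsB x} ≤ (SS n).comap (Yhom b c) := by
    rw [AddSubgroup.closure_le]
    exact fun a ha => h a ha
  rw [IsB_closure] at this
  exact this (AddSubgroup.mem_top a)

lemma SS_top : SS n = ⊤ := by
  have key : ∀ a b c : PGrp n, Ymk n a b c ∈ SS n := by
    intro a b c
    refine SS_ext1 (fun a ha => SS_cyc (SS_ext1 (fun b hb => SS_cyc (SS_ext1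
      (fun c hc => SS_cyc (SS_basis ha hb hc)) c)) b)) a
  rw [eq_top_iff]
  rintro x -
  obtain ⟨y, rfl⟩ := QuotientAddGroup.mk_surjective x
  induction y using FreeAbelianGroup.induction_on with
  | zero => exact zero_mem _
  | of z => exact key z.1 z.2.1 z.2.2
  | neg z h => exact neg_mem h
  | add x y hx hy => exact add_mem hx hy

lemma A1_hom_ext {M : Type*} [AddCommGroup M] (f g : A1 n →+ M)
    (h : ∀ x, IsStd x → f x = g x) : f = g := by
  apply AddMonoidHom.eq_of_eqOn_dense (s := {x | IsStd x}) SS_top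
  exact fun x hx => h x hx

/-- Construct a homomorphism out of `A₁(P)`. -/
def A1lift {M : Type*} [AddCommGroup M] (f : PGrp n → PGrp n → PGrp n → M)
    (h1 : ∀ a b c d, f (a + b) c d = f a c d + f b c d)
    (h2 : ∀ a b c, f a b c = f b c a) (h3 : ∀ a b, f a a b = f (sP n) a b) : A1 n →+ M :=
  QuotientAddGroup.lift (A1rels n) (FreeAbelianGroup.lift fun z => f z.1 z.2.1 z.2.2) (by
    rw [A1rels, AddSubgroup.closure_le]
    rintro x ((⟨a, b, c, d, rfl⟩ | ⟨a, b, c, rfl⟩) | ⟨a, b, rfl⟩)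
    · simp [h1]
    · simp [← h2 a b c]
    · simp [h3])

lemma A1lift_Ymk {M : Type*} [AddCommGroup M] (f : PGrp n → PGrp n → PGrp n → M)
    (h1 h2 h3) (a b c : PGrp n) : A1lift f h1 h2 h3 (Ymk n a b c) = f a b c :=
  FreeAbelianGroup.lift_apply_of _ _

section W
variable {R M : Type*} [CommRing R] [AddCommGroup M] [Module R M]

lemma wedge_eq (k : ℕ) (v : Fin k → M) : wedge (R := R) k v = exteriorPower.ιMulti R k v := rfl

lemma w3_add (a b c d : M) : wedge (R := R) 3 ![a + b, c, d] =
    wedge 3 ![a, c, d] + wedge 3 ![b, c, d] := by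
  simp only [wedge_eq]
  exact AlternatingMap.map_vecCons_add _ _ _ _

lemma w3_self (a b : M) : wedge (R := R) 3 ![a, a, b] = 0 := by
  simp only [wedge_eq]
  exact AlternatingMap.map_eq_zero_of_eq _ _ (i := 0) (j := 1) rfl (by decide)

lemma w3_zero (a b : M) : wedge (R := R) 3 ![0, a, b] = 0 := by
  simp only [wedge_eq]
  exact AlternatingMap.map_coord_zero _ 0 rfl

lemma w3_cyc (a b c : M) : wedge (R := R) 3 ![a, b, c] = wedge 3 ![b, c, a] := by
  simp only [wedge_eq]
  have h1 := AlternatingMap.map_swap (exteriorPower.ιMulti R 3) ![a, b, c] (i := 0) (j := 1)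
    (by decide)
  have h2 := AlternatingMap.map_swap (exteriorPower.ιMulti R 3) ![b, a, c] (i := 1) (j := 2)
    (by decide)
  have e1 : ![a, b, c] ∘ Equiv.swap (0 : Fin 3) 1 = ![b, a, c] := by
    ext i; fin_cases i <;> rfl
  have e2 : ![b, a, c] ∘ Equiv.swap (1 : Fin 3) 2 = ![b, c, a] := by
    ext i; fin_cases i <;> rfl
  rw [e1] at h1
  rw [e2] at h2
  rw [h2, h1, neg_neg]

lemma w2_add (a b c : M) : wedge (R := R) 2 ![a + b, c] =
    wedge 2 ![a, c] + wedge 2 ![b, c] := by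
  simp only [wedge_eq]
  exact AlternatingMap.map_vecCons_add _ _ _ _

lemma w2_self (a : M) : wedge (R := R) 2 ![a, a] = 0 := by
  simp only [wedge_eq]
  exact AlternatingMap.map_eq_zero_of_eq _ _ (i := 0) (j := 1) rfl (by decide)

lemma w2_zero (a : M) : wedge (R := R) 2 ![0, a] = 0 := by
  simp only [wedge_eq]
  exact AlternatingMap.map_coord_zero _ 0 rfl

lemma w2_swap (a b : M) : wedge (R := R) 2 ![a, b] = - wedge 2 ![b, a] := by
  simp only [wedge_eq]
  have h1 := AlternatingMap.map_swap (exteriorPower.ιMulti R 2) ![b, a] (i := 0) (j := 1)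
    (by decide)
  have e1 : ![b, a] ∘ Equiv.swap (0 : Fin 2) 1 = ![a, b] := by
    ext i; fin_cases i <;> rfl
  rw [e1] at h1
  exact h1

lemma w2_zero' (a : M) : wedge (R := R) 2 ![a, 0] = 0 := by
  rw [w2_swap, w2_zero, neg_zero]

lemma w2_add' (a b c : M) : wedge (R := R) 2 ![c, a + b] =
    wedge 2 ![c, a] + wedge 2 ![c, b] := by
  rw [w2_swap, w2_add, w2_swap c a, w2_swap c b, neg_add]

end W

lemma zmod2_add_self {M : Type*} [AddCommGroup M] [Module (ZMod 2) M] (x : M) : x + x = 0 := by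
  have h : (1 + 1 : ZMod 2) = 0 := by decide
  rw [← one_smul (ZMod 2) x, ← add_smul, h, zero_smul]

lemma w2_symm {M : Type*} [AddCommGroup M] [Module (ZMod 2) M] (a b : M) :
    wedge (R := ZMod 2) 2 ![a, b] = wedge 2 ![b, a] := by
  rw [w2_swap, neg_eq_iff_add_eq_zero, zmod2_add_self]

/-- Reduction mod 2. -/
def red (x : Fin n → ℤ) : Fin n → ZMod 2 := fun i => (x i : ZMod 2)

lemma red_add (x y : Fin n → ℤ) : red (x + y) = red x + red y := by ext; simp [red]

lemma red_zero : red (0 : Fin n → ℤ) = 0 := by ext; simp [red]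

lemma red_e (i : Fin n) : red (eZ n i) = eZ2 n i := by
  ext j; by_cases h : j = i <;> simp [red, eZ, eZ2, Pi.single_apply, h]

lemma sq2 (x : Fin n → ZMod 2) : x * x = x := by
  ext i
  have : ∀ t : ZMod 2, t * t = t := by decide
  exact this _

lemma e_mul {i j : Fin n} (h : i ≠ j) : eZ2 n i * eZ2 n j = 0 := by
  ext k
  simp only [eZ2, Pi.mul_apply, Pi.single_apply, Pi.zero_apply]
  split_ifs <;> simp_all

/-- The quadratic component. -/
noncomputable def F2 (a b c : PGrp n) : ⋀[ZMod 2]^2 (Fin n → ZMod 2) :=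
  wedge 2 ![red a.1 * red b.1, red c.1] + wedge 2 ![red b.1 * red c.1, red a.1] +
  wedge 2 ![red c.1 * red a.1, red b.1] + a.2 • wedge 2 ![red b.1, red c.1] +
  b.2 • wedge 2 ![red c.1, red a.1] + c.2 • wedge 2 ![red a.1, red b.1]

/-- The linear component. -/
def F1 (a b c : PGrp n) : Fin n → ZMod 2 :=
  red a.1 * red b.1 * red c.1 + a.2 • (red b.1 * red c.1) + b.2 • (red c.1 * red a.1)
    + c.2 • (red a.1 * red b.1) + (a.2 * b.2) • red c.1 + (b.2 * c.2) • red a.1 +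
    (c.2 * a.2) • red b.1

lemma F2_add (a b c d : PGrp n) : F2 (a + b) c d = F2 a c d + F2 b c d := by
  simp only [F2, Prod.fst_add, Prod.snd_add, red_add, add_mul, mul_add, w2_add, w2_add',
    add_smul, smul_add]
  abel

lemma F2_cyc (a b c : PGrp n) : F2 a b c = F2 b c a := by
  simp only [F2]; abel

lemma F2_slide (a c : PGrp n) : F2 a a c = F2 (sP n) a c := by
  simp only [F2, sP, red_zero, sq2, zero_mul, mul_zero, w2_zero, w2_zero', w2_self, smul_zero,
    one_smul, mul_comm (red c.1) (red a.1), w2_symm (red c.1) (red a.1), add_zero, zero_add]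
  have h1 := zmod2_add_self (wedge (R := ZMod 2) 2 ![red a.1 * red c.1, red a.1])
  have h2 := zmod2_add_self (a.2 • wedge (R := ZMod 2) 2 ![red a.1, red c.1])
  rw [add_assoc (wedge 2 ![red a.1, red c.1]), h1, add_zero, add_assoc, h2, add_zero]

lemma F1_add (a b c d : PGrp n) : F1 (a + b) c d = F1 a c d + F1 b c d := by
  ext i
  simp only [F1, Prod.fst_add, Prod.snd_add, red_add, Pi.add_apply, Pi.mul_apply, Pi.smul_apply,
    smul_eq_mul]
  ring

lemma F1_cyc (a b c : PGrp n) : F1 a b c = F1 b c a := by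
  ext i
  simp only [F1, Pi.add_apply, Pi.mul_apply, Pi.smul_apply, smul_eq_mul]
  ring

lemma F1_slide (a c : PGrp n) : F1 a a c = F1 (sP n) a c := by
  ext i
  simp only [F1, sP, red_zero, Pi.add_apply, Pi.mul_apply, Pi.smul_apply, smul_eq_mul,
    Pi.zero_apply]
  generalize red a.1 i = x, red c.1 i = z, a.2 = α, c.2 = γ
  revert x z α γ
  decide

/-- The target group. -/
abbrev Tgt (n : ℕ) := (⋀[ℤ]^3 (Fin n → ℤ)) ×
        (⋀[ZMod 2]^2 (Fin n → ZMod 2)) × (Fin n → ZMod 2) × ZMod 2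

/-- The forward map. -/
noncomputable def fwd (n : ℕ) : A1 n →+ Tgt n :=
  A1lift (fun a b c => (wedge 3 ![a.1, b.1, c.1], F2 a b c, F1 a b c, a.2 * b.2 * c.2))
    (fun a b c d => by
      simp only [Prod.fst_add, Prod.snd_add, w3_add, F2_add, F1_add, add_mul, Prod.mk_add_mk])
    (fun a b c => by rw [w3_cyc, F2_cyc, F1_cyc, mul_assoc, mul_comm])
    (fun a c => by
      rw [w3_self, F2_slide, F1_slide]
      have : ∀ t : ZMod 2, t * t = t := by decide
      simp [sP, w3_zero, this])

lemma fwd_eee {i j k : Fin n} (h : i < j) (h' : j < k) :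
    fwd n (Ymk n (eZ n i, 0) (eZ n j, 0) (eZ n k, 0)) =
          (wedge 3 ![eZ n i, eZ n j, eZ n k], 0, 0, 0) := by
  rw [fwd, A1lift_Ymk]
  simp [F1, F2, red_e, e_mul h.ne, e_mul h'.ne, e_mul (h.trans h').ne', w2_zero]

lemma fwd_ees {i j : Fin n} (h : i < j) :
    fwd n (Ymk n (eZ n i, 0) (eZ n j, 0) (sP n)) = (0, wedge 2 ![eZ2 n i, eZ2 n j], 0, 0) := by
  rw [fwd, A1lift_Ymk]
  simp [F1, F2, sP, red_e, red_zero, e_mul h.ne, w2_zero, w2_zero', w3_cyc (eZ n i),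
    w3_cyc (eZ n j), w3_zero]

lemma fwd_ess (i : Fin n) :
    fwd n (Ymk n (eZ n i, 0) (sP n) (sP n)) = (0, 0, eZ2 n i, 0) := by
  rw [fwd, A1lift_Ymk]
  simp [F1, F2, sP, red_e, red_zero, w2_zero, w2_zero', w3_cyc (eZ n i), w3_zero]

lemma fwd_sss : fwd n (Ymk n (sP n) (sP n) (sP n)) = (0, 0, 0, 1) := by
  rw [fwd, A1lift_Ymk]
  simp [F1, F2, sP, red_zero, w2_zero, w3_zero]

lemma exists_hom_zmod2 {ι V A : Type*} [AddCommGroup V] [Module (ZMod 2) V] [AddCommGroup A]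
    (b : Module.Basis ι (ZMod 2) V) (f : ι → A) (hf : ∀ i, (2 : ℕ) • f i = 0) :
    ∃ g : V →+ A, ∀ i, g (b i) = f i := by
  let T : AddSubgroup A := (nsmulAddMonoidHom (α := A) 2).ker
  letI : Module (ZMod 2) T := AddCommGroup.zmodModule (n := 2) (by
    rintro ⟨x, hx⟩
    ext
    exact hx)
  let g := b.constr ℕ (fun i => (⟨f i, hf i⟩ : T))
  refine ⟨T.subtype.comp g.toAddMonoidHom, fun i => ?_⟩
  change ((g (b i) : T) : A) = f i
  simp only [g, Module.Basis.constr_basis]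

/-- Standard exterior basis, ordered. -/
lemma ext_basis3 (s : Set.powersetCard (Fin n) 3) : ∃ i j k : Fin n, i < j ∧ j < k ∧
    (Set.powersetCard.ofFinEmbEquiv.symm s : Fin 3 → Fin n) = ![i, j, k] ∧
    (Pi.basisFun ℤ (Fin n)).exteriorPower 3 s = wedge 3 ![eZ n i, eZ n j, eZ n k] := by
  set f := Set.powersetCard.ofFinEmbEquiv.symm s with hf
  have e : (f : Fin 3 → Fin n) = ![f 0, f 1, f 2] := by
    ext x; fin_cases x <;> rfl
  refine ⟨f 0, f 1, f 2, f.strictMono (by decide), f.strictMono (by decide), e, ?_⟩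
  rw [exteriorPower.basis_apply, exteriorPower.ιMulti_family, ← hf, wedge_eq]
  congr 1
  ext x : 1
  fin_cases x <;> simp [eZ]

lemma ext_basis2 (s : Set.powersetCard (Fin n) 2) : ∃ i j : Fin n, i < j ∧
    (Set.powersetCard.ofFinEmbEquiv.symm s : Fin 2 → Fin n) = ![i, j] ∧
    (Pi.basisFun (ZMod 2) (Fin n)).exteriorPower 2 s = wedge 2 ![eZ2 n i, eZ2 n j] := by
  set f := Set.powersetCard.ofFinEmbEquiv.symm s with hf
  have e : (f : Fin 2 → Fin n) = ![f 0, f 1] := by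
    ext x; fin_cases x <;> rfl
  refine ⟨f 0, f 1, f.strictMono (by decide), e, ?_⟩
  rw [exteriorPower.basis_apply, exteriorPower.ιMulti_family, ← hf, wedge_eq]
  congr 1
  ext x : 1
  fin_cases x <;> simp [eZ2]

lemma ext_basis3' {i j k : Fin n} (h : i < j) (h' : j < k) :
    ∃ s : Set.powersetCard (Fin n) 3,
      (Set.powersetCard.ofFinEmbEquiv.symm s : Fin 3 → Fin n) = ![i, j, k] := by
  have hm : StrictMono ![i, j, k] := by
    rw [Fin.strictMono_iff_lt_succ]
    intro x; fin_cases x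
    · exact h
    · exact h'
  exact ⟨Set.powersetCard.ofFinEmbEquiv (OrderEmbedding.ofStrictMono _ hm), by simp⟩

lemma ext_basis2' {i j : Fin n} (h : i < j) :
    ∃ s : Set.powersetCard (Fin n) 2,
      (Set.powersetCard.ofFinEmbEquiv.symm s : Fin 2 → Fin n) = ![i, j] := by
  have hm : StrictMono ![i, j] := by
    rw [Fin.strictMono_iff_lt_succ]
    intro x; fin_cases x
    exact h
  exact ⟨Set.powersetCard.ofFinEmbEquiv (OrderEmbedding.ofStrictMono _ hm), by simp⟩

lemma exists_g3 (n : ℕ) : ∃ g : (⋀[ℤ]^3 (Fin n → ℤ)) →+ A1 n, ∀ i j k, i < j → j < k →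
    g (wedge 3 ![eZ n i, eZ n j, eZ n k]) = Ymk n (eZ n i, 0) (eZ n j, 0) (eZ n k, 0) := by
  let b := (Pi.basisFun ℤ (Fin n)).exteriorPower 3
  let g := b.constr ℕ (fun s =>
    let f := Set.powersetCard.ofFinEmbEquiv.symm s
    Ymk n (eZ n (f 0), 0) (eZ n (f 1), 0) (eZ n (f 2), 0))
  refine ⟨g.toAddMonoidHom, fun i j k h h' => ?_⟩
  obtain ⟨s, hs⟩ := ext_basis3' h h'
  obtain ⟨i', j', k', -, -, hs', hb⟩ := ext_basis3 s
  have e := hs.symm.trans hs'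
  obtain rfl : i = i' := congrFun e 0
  obtain rfl : j = j' := congrFun e 1
  obtain rfl : k = k' := congrFun e 2
  rw [← hb]
  change g (b s) = _
  simp only [g, Module.Basis.constr_basis, hs]
  rfl

lemma exists_g2 (n : ℕ) : ∃ g : (⋀[ZMod 2]^2 (Fin n → ZMod 2)) →+ A1 n, ∀ i j, i < j →
    g (wedge 2 ![eZ2 n i, eZ2 n j]) = Ymk n (eZ n i, 0) (eZ n j, 0) (sP n) := by
  let b := (Pi.basisFun (ZMod 2) (Fin n)).exteriorPower 2
  obtain ⟨g, hg⟩ := exists_hom_zmod2 b (fun s =>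
    let f := Set.powersetCard.ofFinEmbEquiv.symm s
    Ymk n (eZ n (f 0), 0) (eZ n (f 1), 0) (sP n))
    (fun s => by simp only [← Ymk_cyc (sP n)]; exact Ymk_s_two _ _)
  refine ⟨g, fun i j h => ?_⟩
  obtain ⟨s, hs⟩ := ext_basis2' h
  obtain ⟨i', j', -, hs', hb⟩ := ext_basis2 s
  have e := hs.symm.trans hs'
  obtain rfl : i = i' := congrFun e 0
  obtain rfl : j = j' := congrFun e 1
  rw [← hb]
  refine (hg s).trans ?_
  simp only [hs]
  rfl

lemma exists_g1 (n : ℕ) : ∃ g : (Fin n → ZMod 2) →+ A1 n, ∀ i,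
    g (eZ2 n i) = Ymk n (eZ n i, 0) (sP n) (sP n) := by
  obtain ⟨g, hg⟩ := exists_hom_zmod2 (Pi.basisFun (ZMod 2) (Fin n))
    (fun i => Ymk n (eZ n i, 0) (sP n) (sP n))
    (fun s => by rw [← Ymk_cyc (sP n)]; exact Ymk_s_two _ _)
  refine ⟨g, fun i => ?_⟩
  rw [← hg, Pi.basisFun_apply, eZ2]

lemma exists_g0 (n : ℕ) : ∃ g : ZMod 2 →+ A1 n, g 1 = Ymk n (sP n) (sP n) (sP n) := by
  obtain ⟨g, hg⟩ := exists_hom_zmod2 (Module.Basis.singleton Unit (ZMod 2))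
    (fun _ => Ymk n (sP n) (sP n) (sP n)) (fun s => Ymk_s_two _ _)
  refine ⟨g, ?_⟩
  rw [← hg (), Module.Basis.singleton_apply]

lemma zmod2_hom_ext' {ι V A : Type*} [AddCommGroup V] [Module (ZMod 2) V] [AddCommGroup A]
    (b : Module.Basis ι (ZMod 2) V) (f g : V →+ A)
    (h : ∀ i, f (b i) = g (b i)) : f = g := by
  have hb := b.span_eq
  ext v
  have hv : v ∈ Submodule.span (ZMod 2) (Set.range b) := by rw [hb]; trivial
  induction hv using Submodule.span_induction with
  | mem x hx => obtain ⟨i, rfl⟩ := hx; exact h i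
  | zero => simp
  | add x y _ _ hx hy => simp [hx, hy]
  | smul c x _ hx =>
    rw [← ZMod.natCast_zmod_val c, Nat.cast_smul_eq_nsmul, map_nsmul, map_nsmul, hx]

end Helpers

/-- the map `ρ` sending `Y[(eᵢ,0);(eⱼ,0);(e_k,0)] ↦ eᵢ∧eⱼ∧e_k ∈ Λ³H`,
`Y[(eᵢ,0);(eⱼ,0);(0,1)] ↦ ēᵢ∧ēⱼ ∈ Λ²H₍₂₎`, `Y[(eᵢ,0);(0,1);(0,1)] ↦ ēᵢ ∈ H₍₂₎` and
`Y[(0,1);(0,1);(0,1)] ↦ 1 ∈ ℤ/2` (for `1 ≤ i < j < k ≤ n`) is a well-defined isomorphism of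
abelian groups `A₁(P) ≅ Λ³H ⊕ Λ²H₍₂₎ ⊕ H₍₂₎ ⊕ ℤ/2`. -/
theorem A1_iso (n : ℕ) :
    ∃ ρ : A1 n ≃+ (⋀[ℤ]^3 (Fin n → ℤ)) ×
        (⋀[ZMod 2]^2 (Fin n → ZMod 2)) × (Fin n → ZMod 2) × ZMod 2,
      (∀ i j k : Fin n, i < j → j < k →
        ρ (Ymk n (eZ n i, 0) (eZ n j, 0) (eZ n k, 0)) =
          (wedge 3 ![eZ n i, eZ n j, eZ n k], 0, 0, 0)) ∧
      (∀ i j : Fin n, i < j →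
        ρ (Ymk n (eZ n i, 0) (eZ n j, 0) (sP n)) =
          (0, wedge 2 ![eZ2 n i, eZ2 n j], 0, 0)) ∧
      (∀ i : Fin n,
        ρ (Ymk n (eZ n i, 0) (sP n) (sP n)) = (0, 0, eZ2 n i, 0)) ∧
      ρ (Ymk n (sP n) (sP n) (sP n)) = (0, 0, 0, 1) := by
  obtain ⟨g3, h3⟩ := exists_g3 n
  obtain ⟨g2, h2⟩ := exists_g2 n
  obtain ⟨g1, h1⟩ := exists_g1 n
  obtain ⟨g0, h0⟩ := exists_g0 n
  let g : Tgt n →+ A1 n := g3.coprod (g2.coprod (g1.coprod g0))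
  have hgf : g.comp (fwd n) = AddMonoidHom.id _ := by
    apply A1_hom_ext
    rintro x (⟨i, j, k, h, h'⟩ | ⟨i, j, h⟩ | ⟨i⟩ | _)
    · simp [g, fwd_eee h h', h3 _ _ _ h h']
    · simp [g, fwd_ees h, h2 _ _ h]
    · simp [g, fwd_ess, h1]
    · simp [g, fwd_sss, h0]
  have e3 : ((fwd n).comp g3) = AddMonoidHom.inl _ _ := by
    have : ((fwd n).comp g3).toIntLinearMap =
        (AddMonoidHom.inl (⋀[ℤ]^3 (Fin n → ℤ)) _).toIntLinearMap := by
      refine ((Pi.basisFun ℤ (Fin n)).exteriorPower 3).ext fun s => ?_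
      obtain ⟨i, j, k, h, h', -, hb⟩ := ext_basis3 s
      rw [hb]
      change fwd n (g3 _) = _
      rw [h3 _ _ _ h h', fwd_eee h h']
      rfl
    ext1 v
    exact congrArg (fun l => l v) this
  have e2 : ((fwd n).comp g2) = (AddMonoidHom.inr _ _).comp (AddMonoidHom.inl _ _) := by
    refine zmod2_hom_ext' ((Pi.basisFun (ZMod 2) (Fin n)).exteriorPower 2) _ _ fun s => ?_
    obtain ⟨i, j, h, -, hb⟩ := ext_basis2 s
    rw [hb]
    change fwd n (g2 _) = _
    rw [h2 _ _ h, fwd_ees h]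
    rfl
  have e1 : ((fwd n).comp g1) = (AddMonoidHom.inr _ _).comp
      ((AddMonoidHom.inr _ _).comp (AddMonoidHom.inl _ _)) := by
    refine zmod2_hom_ext' (Pi.basisFun (ZMod 2) (Fin n)) _ _ fun i => ?_
    rw [Pi.basisFun_apply]
    change fwd n (g1 (eZ2 n i)) = _
    rw [h1, fwd_ess]
    rfl
  have e0 : ((fwd n).comp g0) = (AddMonoidHom.inr _ _).comp
      ((AddMonoidHom.inr _ _).comp (AddMonoidHom.inr _ _)) := by
    refine zmod2_hom_ext' (Module.Basis.singleton Unit (ZMod 2)) _ _ fun i => ?_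
    rw [Module.Basis.singleton_apply]
    change fwd n (g0 1) = _
    rw [h0, fwd_sss]
    rfl
  have hfg : ∀ t, fwd n (g t) = t := by
    rintro ⟨a, b, c, d⟩
    have q3 := DFunLike.congr_fun e3 a
    have q2 := DFunLike.congr_fun e2 b
    have q1 := DFunLike.congr_fun e1 c
    have q0 := DFunLike.congr_fun e0 d
    simp only [AddMonoidHom.comp_apply, AddMonoidHom.inl_apply, AddMonoidHom.inr_apply]
      at q3 q2 q1 q0
    simp only [g, AddMonoidHom.coprod_apply, map_add, q3, q2, q1, q0]
    simp
  refine ⟨{ toFun := fwd n, invFun := g, left_inv := DFunLike.congr_fun hgf, right_inv := hfg,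
            map_add' := map_add _ }, ?_, ?_, ?_, ?_⟩
  · exact fun i j k h h' => fwd_eee h h'
  · exact fun i j h => fwd_ees h
  · exact fun i => fwd_ess i
  · exact fwd_sss
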